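/- Let n ≥ 6 be a singly-even integer (n ≡ 2 mod 4). Then there is no natural magic square A of order n that is of type A; that is, there is no natural magic square A of order n with magic number μ and MCPM P satisfying A + P·A·P = (2μ/n)·E. -/

import Mathlib

open Matrix

/-- The `n × n` reverse matrix `J`: (1-indexed) `J i j = 1` iff `i + j = n + 1`. -/
def revMat (n : ℕ) : Matrix (Fin n) (Fin n) ℝ :=
  Matrix.of fun i j => if (i : ℕ) + (j : ℕ) + 1 = n then 1 else 0

/-- The `n × n` all-ones matrix `E`. -/
def allOnes (n : ℕ) : Matrix (Fin n) (Fin n) ℝ :=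
  Matrix.of fun _ _ => 1

/-- `A` is a magic square with magic number `μ`: all rows, all columns, the main
diagonal and the minor diagonal sum to `μ`. -/
def IsMagic {n : ℕ} (A : Matrix (Fin n) (Fin n) ℝ) (μ : ℝ) : Prop :=
  (∀ i, ∑ j, A i j = μ) ∧ (∀ j, ∑ i, A i j = μ) ∧
    A.trace = μ ∧ (revMat n * A).trace = μ

/-- `A` is a semi-magic square with magic number `μ`: all rows and columns sum to `μ`. -/
def IsSemiMagic {n : ℕ} (A : Matrix (Fin n) (Fin n) ℝ) (μ : ℝ) : Prop :=
  (∀ i, ∑ j, A i j = μ) ∧ (∀ j, ∑ i, A i j = μ)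

/-- `P` is a permutation matrix: a 0–1 matrix with exactly one 1 in each row and column. -/
def IsPermMat {n : ℕ} (P : Matrix (Fin n) (Fin n) ℝ) : Prop :=
  (∀ i j, P i j = 0 ∨ P i j = 1) ∧ (∀ i, ∃! j, P i j = 1) ∧ (∀ j, ∃! i, P i j = 1)

/-- A square matrix is bisymmetric if it is symmetric and persymmetric. -/
def IsBisym {n : ℕ} (P : Matrix (Fin n) (Fin n) ℝ) : Prop :=
  P = Pᵀ ∧ revMat n * P = (revMat n * P)ᵀ

/-- A square matrix is 90°-symmetric if `Pᵀ = J * P`. -/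
def IsRot90 {n : ℕ} (P : Matrix (Fin n) (Fin n) ℝ) : Prop :=
  Pᵀ = revMat n * P

/-- A magic classifying permutation matrix (MCPM): a symmetric permutation matrix with
trace 0 when `n` is even; when `n` is odd, the middle diagonal entry is 1 and the trace is 1. -/
def IsMCPM {n : ℕ} (P : Matrix (Fin n) (Fin n) ℝ) : Prop :=
  IsPermMat P ∧ P = Pᵀ ∧
    ((Even n ∧ P.trace = 0) ∨
      (Odd n ∧ P.trace = 1 ∧ ∀ i : Fin n, (i : ℕ) = n / 2 → P i i = 1))

/-- `A` is a natural magic square matrix: its entries are a rearrangement of `1, …, n²`. -/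
def IsNatural {n : ℕ} (A : Matrix (Fin n) (Fin n) ℝ) : Prop :=
  Function.Injective (fun p : Fin n × Fin n => A p.1 p.2) ∧
    ∀ i j, ∃ k : Fin (n * n), A i j = (k : ℝ) + 1


/-- Summing over a fixed-point-free involution: group the points in orbits of size two. -/
theorem sum_eq_sum_filter_lt_involution {α M : Type*} [Fintype α] [LinearOrder α]
    [AddCommMonoid M] {σ : α → α} (hσ : Function.Involutive σ) (hfix : ∀ i, σ i ≠ i)
    (f : α → M) :
    ∑ i, f i = ∑ i with i < σ i, (f i + f (σ i)) := by
  rw [← Finset.sum_filter_add_sum_filter_not Finset.univ (fun i => i < σ i) f,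
    Finset.sum_add_distrib]
  congr 1
  refine Finset.sum_nbij' σ σ ?_ ?_ (fun i _ => hσ i) (fun i _ => hσ i) (fun i _ => by rw [hσ i])
  · intro i hi
    simp only [Finset.mem_filter, Finset.mem_univ, true_and, not_lt] at hi ⊢
    rw [hσ i]
    exact lt_of_le_of_ne hi (hfix i)
  · intro i hi
    simp only [Finset.mem_filter, Finset.mem_univ, true_and, not_lt] at hi ⊢
    rw [hσ i]
    exact hi.le

/-- An integer semi-magic square of singly-even order whose entries at `(i, j)` and `(σ i, σ j)`
always add up to `c`, for a fixed-point-free involution `σ`, has `c` even. -/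
theorem even_of_add_involution_eq {n : ℕ} (hn : n % 4 = 2) {σ : Fin n → Fin n}
    (hσ : Function.Involutive σ) (hfix : ∀ i, σ i ≠ i) {B : Fin n → Fin n → ℤ} {c μ : ℤ}
    (hrow : ∀ i, ∑ j, B i j = μ) (hcol : ∀ j, ∑ i, B i j = μ)
    (hc : ∀ i j, B i j + B (σ i) (σ j) = c) : Even c := by
  set H : Finset (Fin n) := {i | i < σ i} with hH
  have hcard : n = 2 * H.card := by
    have h := sum_eq_sum_filter_lt_involution hσ hfix (fun _ => 1)
    simp only [Finset.sum_const, Finset.card_univ, Fintype.card_fin, smul_eq_mul] at h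
    rw [← hH] at h
    lia
  have hr : ∑ i ∈ H, ∑ j ∈ H, B i j + ∑ i ∈ H, ∑ j ∈ H, B i (σ j) = H.card * μ := by
    simp_rw [← Finset.sum_add_distrib, hH, ← sum_eq_sum_filter_lt_involution hσ hfix, hrow]
    simp
  have hl : ∑ i ∈ H, ∑ j ∈ H, B i j + ∑ i ∈ H, ∑ j ∈ H, B (σ i) j = H.card * μ := by
    rw [Finset.sum_comm, Finset.sum_comm (f := fun i j => B (σ i) j)]
    simp_rw [← Finset.sum_add_distrib, hH, ← sum_eq_sum_filter_lt_involution hσ hfix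
      (fun i => B i _), hcol]
    simp
  have hs : ∑ i ∈ H, ∑ j ∈ H, B i (σ j) + ∑ i ∈ H, ∑ j ∈ H, B (σ i) j
      = H.card * (H.card * c) := by
    have h : ∀ i j, B i (σ j) + B (σ i) j = c := fun i j => by
      simpa only [hσ j] using hc i (σ j)
    simp_rw [← Finset.sum_add_distrib, h]
    simp
  have hm : Odd (H.card : ℤ) := by
    rw [Int.odd_coe_nat, Nat.odd_iff]
    lia
  have he : Even ((H.card : ℤ) * (H.card * c)) :=
    ⟨H.card * μ - ∑ i ∈ H, ∑ j ∈ H, B i j, by linarith⟩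
  have hodd := Int.not_even_iff_odd.mpr hm
  simpa [Int.even_mul, hodd] using he

/-- A permutation matrix is the `0`-`1` matrix of a function. -/
theorem IsPermMat.exists_eq_ite {n : ℕ} {P : Matrix (Fin n) (Fin n) ℝ} (hP : IsPermMat P) :
    ∃ σ : Fin n → Fin n, ∀ i j, P i j = if j = σ i then 1 else 0 := by
  choose σ hσ hu using hP.2.1
  refine ⟨σ, fun i j => ?_⟩
  split_ifs with h
  · rw [h]
    exact hσ i
  · exact (hP.1 i j).resolve_right fun h1 => h (hu i j h1)

/-- An MCPM of even order is the matrix of a fixed-point-free involution. -/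
theorem IsMCPM.exists_involutive {n : ℕ} (hn : Even n) {P : Matrix (Fin n) (Fin n) ℝ}
    (hP : IsMCPM P) :
    ∃ σ : Fin n → Fin n, Function.Involutive σ ∧ (∀ i, σ i ≠ i) ∧
      ∀ i j, P i j = if j = σ i then 1 else 0 := by
  obtain ⟨hperm, hsymm, htr⟩ := hP
  obtain ⟨σ, hσ⟩ := hperm.exists_eq_ite
  have htr0 : P.trace = 0 := by
    rcases htr with h | h
    · exact h.2
    · exact absurd hn (Nat.not_even_iff_odd.mpr h.1)
  refine ⟨σ, fun i => ?_, fun i hi => ?_, hσ⟩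
  · have h : P (σ i) i = 1 := by
      rw [hsymm, Matrix.transpose_apply, hσ, if_pos rfl]
    rw [hσ] at h
    by_contra hne
    rw [if_neg (Ne.symm hne)] at h
    exact zero_ne_one h
  · have h0 : P i i = 0 := by
      refine (Finset.sum_eq_zero_iff_of_nonneg fun j _ => ?_).mp htr0 i (Finset.mem_univ i)
      rw [Matrix.diag_apply, hσ]
      split_ifs <;> norm_num
    rw [hσ, if_pos hi.symm] at h0
    exact one_ne_zero h0

/-- Conjugating by the matrix of an involution permutes rows and columns. -/
theorem mul_mul_apply_of_involutive {ι R : Type*} [Fintype ι] [DecidableEq ι]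
    [NonAssocSemiring R] {P : Matrix ι ι R} {σ : ι → ι} (hσ : Function.Involutive σ)
    (hP : ∀ i j, P i j = if j = σ i then 1 else 0) (A : Matrix ι ι R) (i j : ι) :
    (P * A * P) i j = A (σ i) (σ j) := by
  have h : ∀ k, j = σ k ↔ k = σ j := fun k => by
    rw [eq_comm, hσ.eq_iff, eq_comm]
  simp [Matrix.mul_apply, hP, h]

/-- Twice the sum of the entries of a natural square. -/
theorem IsNatural.two_mul_sum {n : ℕ} {A : Matrix (Fin n) (Fin n) ℝ} (hA : IsNatural A) :
    2 * ∑ i, ∑ j, A i j = (n : ℝ) ^ 2 * ((n : ℝ) ^ 2 + 1) := by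
  obtain ⟨hinj, hval⟩ := hA
  choose k hk using hval
  have hbij : Function.Bijective (fun p : Fin n × Fin n => k p.1 p.2) := by
    refine (Fintype.bijective_iff_injective_and_card _).mpr ⟨fun p q hpq => hinj ?_, by simp⟩
    simp only [hk]
    exact congrArg (fun x : Fin (n * n) => (x : ℝ) + 1) hpq
  have hgauss : ∀ m : ℕ, 2 * ∑ x : Fin m, ((x : ℝ) + 1) = m * (m + 1) := by
    intro m
    induction m with
    | zero => simp
    | succ m ih =>
      rw [Fin.sum_univ_castSucc, mul_add]
      simp only [Fin.val_castSucc, Fin.val_last]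
      rw [ih]
      push_cast
      ring
  rw [← Fintype.sum_prod_type' (f := A)]
  simp_rw [hk]
  rw [hbij.sum_comp (fun x : Fin (n * n) => (x : ℝ) + 1), hgauss]
  push_cast
  ring

/-- there are no type A natural magic squares of singly-even order. -/
theorem no_typeA_natural_singly_even (n : ℕ) (hn : 6 ≤ n) (hmod : n % 4 = 2) :
    ¬ ∃ (A P : Matrix (Fin n) (Fin n) ℝ) (μ : ℝ),
        IsMagic A μ ∧ IsNatural A ∧ IsMCPM P ∧
        A + P * A * P = (2 * μ / (n : ℝ)) • allOnes n := by
  rintro ⟨A, P, μ, ⟨hrow, hcol, -, -⟩, hnat, hP, heq⟩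
  have hn2 : n % 2 = 0 := by lia
  obtain ⟨σ, hσ, hfix, hPσ⟩ := hP.exists_involutive (Nat.even_iff.mpr hn2)
  have hn0 : (n : ℝ) ≠ 0 := by
    rw [Nat.cast_ne_zero]
    lia
  have hμ : 2 * μ / (n : ℝ) = (n : ℝ) ^ 2 + 1 := by
    have h := hnat.two_mul_sum
    simp only [hrow, Finset.sum_const, Finset.card_univ, Fintype.card_fin, nsmul_eq_mul] at h
    rw [div_eq_iff hn0]
    apply mul_left_cancel₀ hn0
    linear_combination h
  choose k hk using hnat.2
  have hA : ∀ i j, A i j = (((k i j : ℕ) + 1 : ℤ) : ℝ) := fun i j => by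
    rw [hk]
    push_cast
    rfl
  have hsum : ∀ i j, A i j + A (σ i) (σ j) = (n : ℝ) ^ 2 + 1 := fun i j => by
    have h := congrFun (congrFun heq i) j
    rwa [Matrix.add_apply, mul_mul_apply_of_involutive hσ hPσ, hμ, Matrix.smul_apply,
      allOnes, Matrix.of_apply, smul_eq_mul, mul_one] at h
  let i₀ : Fin n := ⟨0, by lia⟩
  have hceven : Even ((n : ℤ) ^ 2 + 1) := by
    refine even_of_add_involution_eq (B := fun i j => (k i j : ℕ) + 1)
      (μ := ∑ j, (((k i₀ j : ℕ) : ℤ) + 1)) hmod hσ hfix (fun i => ?_) (fun j => ?_) fun i j => ?_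
    · have h := (hrow i).trans (hrow i₀).symm
      simp only [hA] at h
      exact_mod_cast h
    · have h := (hcol j).trans (hrow i₀).symm
      simp only [hA] at h
      exact_mod_cast h
    · have h := hsum i j
      simp only [hA] at h
      exact_mod_cast h
  have hneven : Even (n : ℤ) := (Int.even_coe_nat n).mpr (Nat.even_iff.mpr hn2)
  exact Int.not_even_iff_odd.mpr (hneven.pow_of_ne_zero two_ne_zero).add_one hceven
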